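/- Let ε > 0 and let s ∈ ℝ^n. Let s̃ = s + η where η has i.i.d. coordinates distributed as Laplace with scale 1/ε. Fix indices 1 ≤ i ≤ j ≤ n such that s[k] ≤ 0 for all k ∈ [i,j], and let M̃[i,j] = (Σ_{k=i}^{j} s̃[k])/(j−i+1). Then there exists a universal constant c (independent of n, i, j, ε) such that for all τ ≥ 1: Pr[ M̃[i,j]² · 1{M̃[i,j] ≥ 0} ≥ c·log²((j−i+1)·τ)/((j−i+1)·ε²) ] ≤ 1/((j−i+1)²·τ²). -/

import Mathlib

open MeasureTheory

/-- The Laplace measure on `ℝ` with scale `b`: density `x ↦ (1/(2b))·exp(−|x|/b)`. -/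
noncomputable def laplaceMeasure (b : ℝ) : Measure ℝ :=
  volume.withDensity fun x => ENNReal.ofReal ((2 * b)⁻¹ * Real.exp (-|x| / b))

/-- `seqMean t i j` is the mean `M̃[i,j]` of the entries of `t` with indices in `[i,j]`. -/
noncomputable def seqMean {n : ℕ} (t : Fin n → ℝ) (i j : Fin n) : ℝ :=
  (∑ k ∈ Finset.Icc i j, t k) / (((j : ℕ) - (i : ℕ) + 1 : ℕ) : ℝ)

open ProbabilityTheory

lemma lintegral_ofReal_const_mul_exp_mul_Ioi {K a : ℝ} (hK : 0 ≤ K) (ha : a < 0) (c : ℝ) :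
    ∫⁻ x in Set.Ioi c, ENNReal.ofReal (K * Real.exp (a * x))
      = ENNReal.ofReal (K * (-Real.exp (a * c) / a)) := by
  rw [← ofReal_integral_eq_lintegral_ofReal ((integrableOn_exp_mul_Ioi ha c).const_mul K)
    (.of_forall fun x => by positivity), integral_const_mul, integral_exp_mul_Ioi ha]

lemma lintegral_ofReal_const_mul_exp_mul_Iic {K a : ℝ} (hK : 0 ≤ K) (ha : 0 < a) (c : ℝ) :
    ∫⁻ x in Set.Iic c, ENNReal.ofReal (K * Real.exp (a * x))
      = ENNReal.ofReal (K * (Real.exp (a * c) / a)) := by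
  rw [← ofReal_integral_eq_lintegral_ofReal ((integrableOn_exp_mul_Iic ha c).const_mul K)
    (.of_forall fun x => by positivity), integral_const_mul, integral_exp_mul_Iic ha]

lemma measurable_laplaceDensity (b : ℝ) :
    Measurable fun x : ℝ => ENNReal.ofReal ((2 * b)⁻¹ * Real.exp (-|x| / b)) := by
  fun_prop

/-- The moment generating function of the Laplace distribution. -/
lemma lintegral_exp_mul_laplaceMeasure {b t : ℝ} (hb : 0 < b) (ht : |t * b| < 1) :
    ∫⁻ x, ENNReal.ofReal (Real.exp (t * x)) ∂laplaceMeasure b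
      = ENNReal.ofReal (1 - (t * b) ^ 2)⁻¹ := by
  obtain ⟨h₁, h₂⟩ := abs_lt.1 ht
  have hpos : 0 < t + 1 / b := by
    have : t + 1 / b = (t * b + 1) / b := by field_simp
    rw [this]; exact div_pos (by linarith) hb
  have hneg : t - 1 / b < 0 := by
    have : t - 1 / b = (t * b - 1) / b := by field_simp
    rw [this]; exact div_neg_of_neg_of_pos (by linarith) hb
  have hK : 0 ≤ (2 * b)⁻¹ := by positivity
  rw [laplaceMeasure, lintegral_withDensity_eq_lintegral_mul _ (measurable_laplaceDensity b)
      (by fun_prop), ← lintegral_add_compl _ (measurableSet_Iic (a := (0 : ℝ))), Set.compl_Iic]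
  have hleft : ∀ x ∈ Set.Iic (0 : ℝ),
      ((fun x : ℝ => ENNReal.ofReal ((2 * b)⁻¹ * Real.exp (-|x| / b))) *
        fun x => ENNReal.ofReal (Real.exp (t * x))) x
      = ENNReal.ofReal ((2 * b)⁻¹ * Real.exp ((t + 1 / b) * x)) := by
    intro x hx
    rw [Pi.mul_apply, ← ENNReal.ofReal_mul (by positivity), mul_assoc, ← Real.exp_add,
      abs_of_nonpos hx]
    ring_nf
  have hright : ∀ x ∈ Set.Ioi (0 : ℝ),
      ((fun x : ℝ => ENNReal.ofReal ((2 * b)⁻¹ * Real.exp (-|x| / b))) *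
        fun x => ENNReal.ofReal (Real.exp (t * x))) x
      = ENNReal.ofReal ((2 * b)⁻¹ * Real.exp ((t - 1 / b) * x)) := by
    intro x hx
    rw [Pi.mul_apply, ← ENNReal.ofReal_mul (by positivity), mul_assoc, ← Real.exp_add,
      abs_of_pos hx]
    ring_nf
  rw [setLIntegral_congr_fun measurableSet_Iic hleft,
    setLIntegral_congr_fun measurableSet_Ioi hright,
    lintegral_ofReal_const_mul_exp_mul_Iic hK hpos, lintegral_ofReal_const_mul_exp_mul_Ioi hK hneg,
    ← ENNReal.ofReal_add (by positivity)
      (mul_nonneg hK (div_nonneg_of_nonpos (by simp) hneg.le))]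
  congr 1
  have e₁ : t * b + 1 ≠ 0 := by linarith
  have e₂ : t * b - 1 ≠ 0 := by linarith
  have f₁ : t + 1 / b = (t * b + 1) / b := by field_simp
  have f₂ : t - 1 / b = (t * b - 1) / b := by field_simp
  rw [f₁, f₂, show 1 - (t * b) ^ 2 = -((t * b + 1) * (t * b - 1)) by ring]
  simp only [mul_zero, Real.exp_zero]
  clear hpos hneg f₁ f₂ hleft hright ht h₁ h₂
  generalize t * b = u at *
  field_simp
  ring

lemma isProbabilityMeasure_laplaceMeasure {b : ℝ} (hb : 0 < b) :
    IsProbabilityMeasure (laplaceMeasure b) :=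
  ⟨by simpa using lintegral_exp_mul_laplaceMeasure (t := 0) hb (by simp)⟩

lemma laplaceMeasure_Ici_le {a b : ℝ} (hb : 0 < b) (ha : 0 ≤ a) :
    laplaceMeasure b (Set.Ici a) ≤ ENNReal.ofReal (Real.exp (-a / b)) := by
  have hcongr : ∀ x ∈ Set.Ioi a, ENNReal.ofReal ((2 * b)⁻¹ * Real.exp (-|x| / b))
      = ENNReal.ofReal ((2 * b)⁻¹ * Real.exp (-(1 / b) * x)) := by
    intro x hx
    rw [abs_of_pos (ha.trans_lt hx)]
    ring_nf
  have hb' : -(1 / b) < 0 := by simpa using hb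
  rw [laplaceMeasure, withDensity_apply _ measurableSet_Ici, setLIntegral_congr Ioi_ae_eq_Ici.symm,
    setLIntegral_congr_fun measurableSet_Ioi hcongr,
    lintegral_ofReal_const_mul_exp_mul_Ioi (by positivity) hb']
  apply ENNReal.ofReal_le_ofReal
  have : (2 * b)⁻¹ * (-Real.exp (-(1 / b) * a) / -(1 / b)) = Real.exp (-a / b) / 2 := by
    rw [show -(1 / b) * a = -a / b by ring]
    field_simp
  rw [this]
  linarith [Real.exp_pos (-a / b)]

/-- Chernoff bound for sums of independent Laplace variables. -/
lemma pi_laplaceMeasure_sum_ge_le {ι : Type*} [Fintype ι] (S : Finset ι) {b t : ℝ} (hb : 0 < b)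
    (ht : 0 ≤ t) (htb : t * b < 1) (a : ℝ) :
    (Measure.pi fun _ : ι => laplaceMeasure b) {ω | a ≤ ∑ k ∈ S, ω k}
      ≤ ENNReal.ofReal (Real.exp (-(t * a)) * (1 - (t * b) ^ 2)⁻¹ ^ S.card) := by
  have := isProbabilityMeasure_laplaceMeasure hb
  have habs : |t * b| < 1 := by rwa [abs_of_nonneg (by positivity)]
  have hsq : 0 ≤ 1 - (t * b) ^ 2 := sub_nonneg.2 ((sq_lt_one_iff_abs_lt_one _).2 habs).le
  have hindep : iIndepFun (fun (k : ι) (ω : ι → ℝ) => ENNReal.ofReal (Real.exp (t * ω k)))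
      (Measure.pi fun _ : ι => laplaceMeasure b) :=
    iIndepFun_pi (X := fun _ x => ENNReal.ofReal (Real.exp (t * x)))
      fun _ => by fun_prop
  have hexp : ∀ ω : ι → ℝ, ENNReal.ofReal (Real.exp (t * ∑ k ∈ S, ω k))
      = ∏ k ∈ S, ENNReal.ofReal (Real.exp (t * ω k)) := by
    intro ω
    rw [Finset.mul_sum, Real.exp_sum, ENNReal.ofReal_prod_of_nonneg fun _ _ => by positivity]
  have hlint : ∫⁻ ω, ENNReal.ofReal (Real.exp (t * ∑ k ∈ S, ω k))
      ∂(Measure.pi fun _ : ι => laplaceMeasure b)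
      = ENNReal.ofReal ((1 - (t * b) ^ 2)⁻¹ ^ S.card) := by
    simp_rw [hexp]
    rw [lintegral_prod_eq_prod_lintegral_of_indepFun S _ hindep fun _ => by fun_prop,
      ENNReal.ofReal_pow (by positivity), ← lintegral_exp_mul_laplaceMeasure hb habs]
    refine Finset.prod_eq_pow_card fun k _ => ?_
    exact (measurePreserving_eval (fun _ : ι => laplaceMeasure b) k).lintegral_comp
      (f := fun x => ENNReal.ofReal (Real.exp (t * x))) (by fun_prop)
  calc (Measure.pi fun _ : ι => laplaceMeasure b) {ω | a ≤ ∑ k ∈ S, ω k}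
      ≤ (Measure.pi fun _ : ι => laplaceMeasure b)
          {ω | ENNReal.ofReal (Real.exp (t * a))
            ≤ ENNReal.ofReal (Real.exp (t * ∑ k ∈ S, ω k))} := by
        refine measure_mono fun ω hω => ENNReal.ofReal_le_ofReal (Real.exp_le_exp.2 ?_)
        exact mul_le_mul_of_nonneg_left hω ht
    _ ≤ ENNReal.ofReal ((1 - (t * b) ^ 2)⁻¹ ^ S.card) / ENNReal.ofReal (Real.exp (t * a)) := by
        rw [← hlint]
        exact meas_ge_le_lintegral_div (by fun_prop) (by simp [Real.exp_pos]) (by simp)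
    _ = ENNReal.ofReal (Real.exp (-(t * a)) * (1 - (t * b) ^ 2)⁻¹ ^ S.card) := by
        rw [← ENNReal.ofReal_div_of_pos (Real.exp_pos _), Real.exp_neg, div_eq_inv_mul]

lemma inv_one_sub_inv_four_mul_pow_le {m : ℕ} (hm : 0 < m) :
    (1 - 1 / (4 * m : ℝ))⁻¹ ^ m ≤ Real.exp (1 / 2) := by
  have hm' : (1 : ℝ) ≤ m := by exact_mod_cast hm
  have hx : 1 / (4 * m : ℝ) ≤ 1 / 4 := one_div_le_one_div_of_le (by norm_num) (by linarith)
  have hx₀ : 0 < 1 / (4 * m : ℝ) := by positivity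
  have h : (1 - 1 / (4 * m : ℝ))⁻¹ ≤ Real.exp (1 / (2 * m)) := by
    refine le_trans ?_ (Real.add_one_le_exp _)
    rw [inv_le_iff_one_le_mul₀ (by linarith),
      show (1 / (2 * m) : ℝ) = 2 * (1 / (4 * m)) by ring]
    nlinarith
  calc (1 - 1 / (4 * m : ℝ))⁻¹ ^ m ≤ Real.exp (1 / (2 * m)) ^ m :=
        pow_le_pow_left₀ (inv_nonneg.2 (by linarith)) h m
    _ = Real.exp (1 / 2) := by rw [← Real.exp_nat_mul]; congr 1; field_simp

/-- Tail bound for a sum of `#S` independent Laplace variables at `6 √#S L / ε`. -/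
lemma pi_laplaceMeasure_sum_ge_le_exp {ι : Type*} [Fintype ι] {S : Finset ι} (hS : S.Nonempty)
    {ε L : ℝ} (hε : 0 < ε) (hL : Real.log S.card ≤ L) :
    (Measure.pi fun _ : ι => laplaceMeasure (1 / ε))
        {ω | 6 * √S.card * L / ε ≤ ∑ k ∈ S, ω k} ≤ ENNReal.ofReal (Real.exp (-(2 * L))) := by
  have hb : 0 < 1 / ε := by positivity
  have := isProbabilityMeasure_laplaceMeasure hb
  have hcard : 0 < S.card := hS.card_pos
  obtain hone | htwo : S.card = 1 ∨ 2 ≤ S.card := by omega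
  · obtain ⟨k, rfl⟩ := Finset.card_eq_one.1 hone
    have hL₀ : 0 ≤ L := by simpa using hL
    have hmeas := (measurePreserving_eval (fun _ : ι => laplaceMeasure (1 / ε)) k).measure_preimage
      (measurableSet_Ici (a := 6 * L / ε)).nullMeasurableSet
    simp only [Finset.card_singleton, Nat.cast_one, Real.sqrt_one, mul_one, Finset.sum_singleton]
    refine (hmeas.trans_le (laplaceMeasure_Ici_le hb (by positivity))).trans ?_
    apply ENNReal.ofReal_le_ofReal (Real.exp_le_exp.2 _)
    rw [show -(6 * L / ε) / (1 / ε) = -(6 * L) by field_simp]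
    linarith
  · have hm : (2 : ℝ) ≤ S.card := by exact_mod_cast htwo
    have hhalf : 1 / 2 ≤ L := by
      linarith [Real.log_two_gt_d9, Real.log_le_log (by norm_num) hm]
    have hs : 1 ≤ √(S.card : ℝ) := Real.one_le_sqrt.2 (by linarith)
    have hs₀ : 0 < √(S.card : ℝ) := by linarith
    have htb : ε / (2 * √S.card) * (1 / ε) = 1 / (2 * √S.card) := by field_simp
    have hsq : (1 / (2 * √S.card) : ℝ) ^ 2 = 1 / (4 * S.card) := by
      rw [div_pow, mul_pow, Real.sq_sqrt (by positivity)]; norm_num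
    refine (pi_laplaceMeasure_sum_ge_le S hb (t := ε / (2 * √S.card)) (by positivity) ?_ _).trans ?_
    · rw [htb, div_lt_one (by positivity)]; linarith
    · rw [htb, hsq,
        show ε / (2 * √(S.card : ℝ)) * (6 * √S.card * L / ε) = 3 * L by field_simp; norm_num]
      refine ENNReal.ofReal_le_ofReal ?_
      calc Real.exp (-(3 * L)) * (1 - 1 / (4 * S.card : ℝ))⁻¹ ^ S.card
          ≤ Real.exp (-(3 * L)) * Real.exp (1 / 2) := by
            gcongr; exact inv_one_sub_inv_four_mul_pow_le hcard
        _ ≤ Real.exp (-(2 * L)) := by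
            rw [← Real.exp_add]; exact Real.exp_le_exp.2 (by linarith)

/-- **Concentration of the one-sided squared mean of noisy counts.**
There is a universal constant `c` (independent of `n`, `i`, `j`, `ε`) such that:
if `s̃ = s + η` with `η` i.i.d. `Laplace(1/ε)` and `s[k] ≤ 0` for all `k ∈ [i,j]`,
then for all `τ ≥ 1`,
`Pr[ M̃[i,j]²·1{M̃[i,j] ≥ 0} ≥ c·log²((j−i+1)τ)/((j−i+1)ε²) ] ≤ 1/((j−i+1)²τ²)`. -/
theorem noisy_mean_concentration :
    ∃ c : ℝ, 0 < c ∧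
      ∀ (n : ℕ) (ε : ℝ), 0 < ε → ∀ (s : Fin n → ℝ) (i j : Fin n), i ≤ j →
        (∀ k : Fin n, i ≤ k → k ≤ j → s k ≤ 0) →
        ∀ τ : ℝ, 1 ≤ τ →
          (Measure.pi fun _ : Fin n => laplaceMeasure (1 / ε))
              {ω | c * (Real.log ((((j : ℕ) - (i : ℕ) + 1 : ℕ) : ℝ) * τ)) ^ 2
                    / ((((j : ℕ) - (i : ℕ) + 1 : ℕ) : ℝ) * ε ^ 2)
                  ≤ (if 0 ≤ seqMean (fun k => s k + ω k) i j
                      then (seqMean (fun k => s k + ω k) i j) ^ 2 else 0)}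
            ≤ ENNReal.ofReal (1 / ((((j : ℕ) - (i : ℕ) + 1 : ℕ) : ℝ) ^ 2 * τ ^ 2)) := by
  refine ⟨36, by norm_num, fun n ε hε s i j hij hs τ hτ => ?_⟩
  have hS : (Finset.Icc i j).Nonempty := Finset.nonempty_Icc.2 hij
  have hcard : (j : ℕ) - (i : ℕ) + 1 = (Finset.Icc i j).card := by
    rw [Fin.card_Icc]; have : (i : ℕ) ≤ j := hij; omega
  simp only [seqMean, hcard]
  set S := Finset.Icc i j
  have hm : (1 : ℝ) ≤ S.card := by exact_mod_cast hS.card_pos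
  have hm₀ : (0 : ℝ) < S.card := by linarith
  have hmτ : (S.card : ℝ) ≤ S.card * τ := le_mul_of_one_le_right hm₀.le hτ
  have hlog : Real.log S.card ≤ Real.log (S.card * τ) := Real.log_le_log hm₀ hmτ
  have hbound : Real.exp (-(2 * Real.log (S.card * τ))) = 1 / ((S.card : ℝ) ^ 2 * τ ^ 2) := by
    rw [← Real.log_rpow (by linarith), ← Real.log_inv, Real.exp_log (by positivity)]
    norm_num [mul_pow]
  rw [← hbound]
  have hprob := isProbabilityMeasure_laplaceMeasure (one_div_pos.2 hε)
  obtain hL | hL := (hlog.trans' (Real.log_nonneg hm)).eq_or_lt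
  · rw [← hL]
    rw [mul_zero, neg_zero, Real.exp_zero, ENNReal.ofReal_one]
    exact prob_le_one
  refine (measure_mono fun ω hω => ?_).trans (pi_laplaceMeasure_sum_ge_le_exp hS hε hlog)
  simp only [Set.mem_ofPred_eq] at hω ⊢
  set L := Real.log (S.card * τ)
  have hpos : 0 < 36 * L ^ 2 / (S.card * ε ^ 2) := by positivity
  split_ifs at hω with hmean
  · have hsum : ∑ k ∈ S, (s k + ω k) ≤ ∑ k ∈ S, ω k :=
      Finset.sum_le_sum fun k hk => by
        have := hs k (Finset.mem_Icc.1 hk).1 (Finset.mem_Icc.1 hk).2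
        linarith
    refine le_trans ?_ hsum
    have hsum₀ : 0 ≤ ∑ k ∈ S, (s k + ω k) := by
      simpa [div_mul_cancel₀ _ hm₀.ne'] using mul_nonneg hmean hm₀.le
    refine abs_le_of_sq_le_sq' ?_ hsum₀ |>.2
    rw [div_pow, le_div_iff₀ (by positivity)] at hω
    calc (6 * √(S.card : ℝ) * L / ε) ^ 2
        = 36 * L ^ 2 / (S.card * ε ^ 2) * S.card ^ 2 := by
          rw [div_pow, mul_pow, mul_pow, Real.sq_sqrt hm₀.le]; field_simp; norm_num
      _ ≤ _ := hω
  · exact absurd hω hpos.not_ge
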